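/- Let M be a q-isometry (Mᵀ J M = J). Suppose there exists a vector v ∈ ℝ^{n+1} with q(v) > 0 and M v = v (a fixed point of the induced isometry in hyperbolic space). Then M is semisimple and every complex eigenvalue of M has modulus 1. -/

import Mathlib

open Matrix

noncomputable section

/-- The Minkowski form matrix `diag(1, -1, …, -1)` on `ℝ^{n+1}`. -/
def Jmat (n : ℕ) : Matrix (Fin (n + 1)) (Fin (n + 1)) ℝ :=
  Matrix.diagonal fun i => if i = 0 then (1 : ℝ) else -1

/-- The Minkowski quadratic form `q(v) = vᵀ J v` of signature `(1, n)`. -/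
def qform (n : ℕ) (v : Fin (n + 1) → ℝ) : ℝ := v ⬝ᵥ (Jmat n).mulVec v

/-- `M` is semisimple as an `ℝ`-linear endomorphism of `ℝ^{n+1}`: every
`M`-invariant subspace has an `M`-invariant complement. -/
def IsSemisimpleMat (n : ℕ) (M : Matrix (Fin (n + 1)) (Fin (n + 1)) ℝ) : Prop :=
  ∀ p : Submodule ℝ (Fin (n + 1) → ℝ), (∀ v ∈ p, M.mulVec v ∈ p) →
    ∃ p' : Submodule ℝ (Fin (n + 1) → ℝ), (∀ v ∈ p', M.mulVec v ∈ p') ∧ IsCompl p p'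

/-- The Minkowski bilinear form. -/
def Lform (n : ℕ) : LinearMap.BilinForm ℝ (Fin (n + 1) → ℝ) := Matrix.toBilin' (Jmat n)

lemma Lform_apply (n : ℕ) (x y : Fin (n + 1) → ℝ) :
    Lform n x y = x 0 * y 0 - ∑ i : Fin n, x i.succ * y i.succ := by
  simp [Lform, Matrix.toBilin'_apply', Jmat, dotProduct, Matrix.mulVec_diagonal,
    Fin.sum_univ_succ, Fin.succ_ne_zero, sub_eq_add_neg]

lemma Lform_symm (n : ℕ) (x y : Fin (n + 1) → ℝ) : Lform n x y = Lform n y x := by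
  simp [Lform_apply, mul_comm]

/-- The auxiliary positive definite form. -/
def Bform (n : ℕ) (v : Fin (n + 1) → ℝ) : LinearMap.BilinForm ℝ (Fin (n + 1) → ℝ) :=
  (2 : ℝ) • LinearMap.BilinForm.linMulLin (Lform n v) (Lform n v) - (Lform n v v) • Lform n

lemma Bform_apply (n : ℕ) (v x y : Fin (n + 1) → ℝ) :
    Bform n v x y = 2 * (Lform n v x * Lform n v y) - Lform n v v * Lform n x y := by
  simp [Bform]

lemma Bform_symm (n : ℕ) (v x y : Fin (n + 1) → ℝ) : Bform n v x y = Bform n v y x := by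
  rw [Bform_apply, Bform_apply, Lform_symm n x y]; ring

lemma Bform_pos (n : ℕ) (v : Fin (n + 1) → ℝ) (hv : 0 < Lform n v v)
    (x : Fin (n + 1) → ℝ) (hx : x ≠ 0) : 0 < Bform n v x x := by
  have hb : v 0 ≠ 0 := by
    intro h
    rw [Lform_apply, h] at hv
    have : 0 ≤ ∑ i : Fin n, v i.succ * v i.succ :=
      Finset.sum_nonneg fun i _ => mul_self_nonneg _
    linarith
  set w : Fin (n + 1) → ℝ := v 0 • x - x 0 • v with hw
  have hw0 : w 0 = 0 := by simp [hw, mul_comm]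
  have hq : Lform n w w = - ∑ i : Fin n, w i.succ * w i.succ := by
    rw [Lform_apply, hw0]; ring
  have hq2 : Lform n w w = v 0 ^ 2 * Lform n x x - 2 * v 0 * x 0 * Lform n v x
      + x 0 ^ 2 * Lform n v v := by
    simp only [hw, map_sub, map_smul, LinearMap.sub_apply, LinearMap.smul_apply, smul_eq_mul]
    rw [Lform_symm n x v]; ring
  have hS : 0 ≤ ∑ i : Fin n, w i.succ * w i.succ :=
    Finset.sum_nonneg fun i _ => mul_self_nonneg _
  set S := ∑ i : Fin n, w i.succ * w i.succ with hSdef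
  have key : v 0 ^ 2 * Bform n v x x = v 0 ^ 2 * Lform n v x ^ 2
      + (x 0 * Lform n v v - v 0 * Lform n v x) ^ 2 + Lform n v v * S := by
    rw [Bform_apply]
    have : S = - (v 0 ^ 2 * Lform n x x - 2 * v 0 * x 0 * Lform n v x
      + x 0 ^ 2 * Lform n v v) := by linarith
    rw [this]; ring
  have h1 : 0 ≤ v 0 ^ 2 * Lform n v x ^ 2 := by positivity
  have h2 : 0 ≤ (x 0 * Lform n v v - v 0 * Lform n v x) ^ 2 := by positivity
  have h3 : 0 ≤ Lform n v v * S := by positivity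
  by_contra hneg
  have hle : v 0 ^ 2 * Bform n v x x ≤ 0 :=
    mul_nonpos_of_nonneg_of_nonpos (by positivity) (not_lt.mp hneg)
  have e1 : v 0 ^ 2 * Lform n v x ^ 2 = 0 := by linarith
  have e2 : (x 0 * Lform n v v - v 0 * Lform n v x) ^ 2 = 0 := by linarith
  have e3 : Lform n v v * S = 0 := by linarith
  have f1 : Lform n v x = 0 := by simpa [hb] using e1
  have f2 : x 0 = 0 := by simpa [f1, hv.ne'] using e2
  have f3 : S = 0 := by simpa [hv.ne'] using e3
  rw [hSdef, Finset.sum_eq_zero_iff_of_nonneg (fun i _ => mul_self_nonneg _)] at f3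
  apply hx
  funext i
  refine Fin.cases f2 (fun j => ?_) i
  have := f3 j (Finset.mem_univ j)
  simpa [hw, f2, hb] using this

lemma Lform_inv (n : ℕ) (M : Matrix (Fin (n + 1)) (Fin (n + 1)) ℝ)
    (hM : Mᵀ * Jmat n * M = Jmat n) (x y : Fin (n + 1) → ℝ) :
    Lform n (M.mulVec x) (M.mulVec y) = Lform n x y := by
  simp only [Lform, Matrix.toBilin'_apply']
  conv_rhs => rw [← hM]
  rw [← Matrix.mulVec_mulVec, ← Matrix.mulVec_mulVec, Matrix.dotProduct_mulVec x,
    Matrix.vecMul_transpose]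

lemma Bform_inv (n : ℕ) (M : Matrix (Fin (n + 1)) (Fin (n + 1)) ℝ)
    (hM : Mᵀ * Jmat n * M = Jmat n) (v : Fin (n + 1) → ℝ) (hfix : M.mulVec v = v)
    (x y : Fin (n + 1) → ℝ) :
    Bform n v (M.mulVec x) (M.mulVec y) = Bform n v x y := by
  have h : ∀ z, Lform n v (M.mulVec z) = Lform n v z := fun z => by
    conv_lhs => rw [← hfix]
    exact Lform_inv n M hM v z
  simp only [Bform_apply, h, Lform_inv n M hM]

/-- Proposition 2.4, elliptic case: a `q`-isometry fixing a vector `v` with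
`q(v) > 0` is semisimple, with all complex eigenvalues of modulus 1. -/
theorem stmt_2 (n : ℕ) (hn : 1 ≤ n) (M : Matrix (Fin (n + 1)) (Fin (n + 1)) ℝ)
    (hM : Mᵀ * Jmat n * M = Jmat n)
    (v : Fin (n + 1) → ℝ) (hqv : 0 < qform n v) (hfix : M.mulVec v = v) :
    IsSemisimpleMat n M ∧
    ∀ z : ℂ, Polynomial.aeval z M.charpoly = 0 → ‖z‖ = 1 := by
  have hv : 0 < Lform n v v := by
    simpa [Lform, Matrix.toBilin'_apply', qform] using hqv
  have hpos := Bform_pos n v hv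
  have hinv := Bform_inv n M hM v hfix
  constructor
  · intro p hp
    refine ⟨(Bform n v).orthogonal p, ?_, ?_⟩
    · have hsurj : ∀ x ∈ p, ∃ x' ∈ p, M.mulVec x' = x := by
        let f : p →ₗ[ℝ] p := (Matrix.mulVecLin M).restrict hp
        have hinj : Function.Injective f := by
          rw [← LinearMap.ker_eq_bot, LinearMap.ker_eq_bot']
          intro m hm
          have hm' : M.mulVec (m : Fin (n + 1) → ℝ) = 0 := congrArg Subtype.val hm
          by_contra hne
          have h1 := hpos m (fun h => hne (Subtype.ext h))
          rw [← hinv, hm'] at h1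
          simp at h1
        intro x hx
        obtain ⟨y, hy⟩ := LinearMap.injective_iff_surjective.mp hinj ⟨x, hx⟩
        exact ⟨y, y.2, congrArg Subtype.val hy⟩
      intro y hy
      rw [LinearMap.BilinForm.mem_orthogonal_iff] at hy ⊢
      intro x hx
      obtain ⟨x', hx', rfl⟩ := hsurj x hx
      have := hy x' hx'
      rw [hinv, this]
    · rw [LinearMap.BilinForm.isCompl_orthogonal_iff_disjoint]
      · rw [Submodule.disjoint_def]
        intro x hx hx'
        by_contra hne
        have := (LinearMap.BilinForm.mem_orthogonal_iff.mp hx') x hx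
        exact (hpos x hne).ne' this
      · intro x y h
        rw [Bform_symm, h]
  · intro z hz
    have hz' : (M.map (algebraMap ℝ ℂ)).charpoly.eval z = 0 := by
      rw [Matrix.charpoly_map, Polynomial.eval_map_algebraMap, hz]
    rw [Matrix.eval_charpoly, ← Matrix.exists_mulVec_eq_zero_iff] at hz'
    obtain ⟨w, hw, hMw⟩ := hz'
    have hMw' : ∀ i, z * w i = ∑ j, (M i j : ℂ) * w j := by
      intro i
      have := congrFun hMw i
      rw [Matrix.sub_mulVec, Matrix.scalar_apply, Pi.sub_apply, Matrix.mulVec_diagonal] at this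
      simpa [Matrix.mulVec, dotProduct, sub_eq_zero] using this
    set x : Fin (n + 1) → ℝ := fun i => (w i).re with hx
    set y : Fin (n + 1) → ℝ := fun i => (w i).im with hy
    have hMx : M.mulVec x = z.re • x - z.im • y := by
      funext i
      have := congrArg Complex.re (hMw' i)
      simp [Complex.mul_re] at this
      simp [Matrix.mulVec, dotProduct, hx, hy, this]
    have hMy : M.mulVec y = z.re • y + z.im • x := by
      funext i
      have := congrArg Complex.im (hMw' i)
      simp [Complex.mul_im] at this
      simp [Matrix.mulVec, dotProduct, hx, hy, this]
    have hnn : ∀ u, 0 ≤ Bform n v u u := fun u => by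
      by_cases hu : u = 0
      · simp [hu]
      · exact (hpos u hu).le
    have hsum : 0 < Bform n v x x + Bform n v y y := by
      by_cases hx0 : x = 0
      · have hy0 : y ≠ 0 := by
          intro hy0
          apply hw
          funext i
          exact Complex.ext (congrFun hx0 i) (congrFun hy0 i)
        have := hpos y hy0
        have := hnn x
        linarith
      · have := hpos x hx0
        have := hnn y
        linarith
    have h1 := hinv x x
    have h2 := hinv y y
    rw [hMx] at h1
    rw [hMy] at h2
    simp only [map_sub, map_add, map_smul, LinearMap.sub_apply, LinearMap.add_apply,
      LinearMap.smul_apply, smul_eq_mul] at h1 h2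
    have hs := Bform_symm n v x y
    rw [hs] at h1 h2
    have h3 : (z.re ^ 2 + z.im ^ 2) * (Bform n v x x + Bform n v y y)
        = 1 * (Bform n v x x + Bform n v y y) := by linear_combination h1 + h2
    have h4 := mul_right_cancel₀ hsum.ne' h3
    have h5 : ‖z‖ ^ 2 = 1 := by
      rw [Complex.sq_norm, Complex.normSq_apply]; linarith
    nlinarith [norm_nonneg z]
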